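/- Unfolding identity for the kernel function (the identity R_{s,ψ} = (2π)^s Γ(k+1/2−s) ∑_{m≥1} m^{s−1} P_{m,k+1/2,4N,ψ}, in a form with an arbitrary bounded multiplier system): let N ≥ 1 be an integer, κ a real number, z ∈ ℍ, and s a complex number with Re(s) > 1. Let S = {(c, d) ∈ ℤ² : gcd(c, d) = 1 and 4N ∣ c}; for each (c, d) ∈ S fix integers a(c,d), b(c,d) with a(c,d)·d − b(c,d)·c = 1 and set w(c,d) := (a(c,d)·z + b(c,d))/(cz + d) ∈ ℍ. Let W : S → ℂ be any function such that the double family ((c,d), m) ↦ W(c,d) · (cz + d)^{-κ} · m^{s−1} · e^{2πi·m·w(c,d)}, indexed by (c,d) ∈ S and positive integers m, is absolutely summable. Then (1/2)·e^{πis/2}·Γ(s)·Γ(κ−s) · ∑_{(c,d) ∈ S} W(c,d)·(cz+d)^{-κ} · ∑_{n ∈ ℤ} (w(c,d) + n)^{-s} = (2π)^s·Γ(κ−s) · ∑_{m=1}^{∞} m^{s−1} · (1/2) ∑_{(c,d) ∈ S} W(c,d)·(cz+d)^{-κ}·e^{2πi·m·w(c,d)}, where all the indicated series converge absolutely. -/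

import Mathlib

open Complex Real

/-- The index set of the half-integral weight Poincaré series of level `4N`:
coprime pairs `(c, d)` of integers with `4N ∣ c`. -/
def PoincareIndex (N : ℤ) : Type :=
  {p : ℤ × ℤ // IsCoprime p.1 p.2 ∧ (4 * N) ∣ p.1}

/-- Holomorphy in the parameter `r` of the integral `∫ t ^ (a - 1) * exp (-(r * t))`. -/
lemma differentiableAt_integral_cpow_mul_exp_neg_mul_Ioi {a r : ℂ} (ha : 0 < a.re)
    (hr : 0 < r.re) :
    DifferentiableAt ℂ
      (fun r : ℂ ↦ ∫ t : ℝ in Set.Ioi 0, (t : ℂ) ^ (a - 1) * Complex.exp (-(r * t))) r := by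
  have hcont (r : ℂ) : ContinuousOn (fun t : ℝ ↦ (t : ℂ) ^ (a - 1) * Complex.exp (-(r * t)))
      (Set.Ioi 0) := by
    refine ContinuousOn.mul (fun t ht ↦ ?_) (by fun_prop)
    exact (Complex.continuousAt_ofReal_cpow_const t _
      (Or.inr (ne_of_gt ht))).continuousWithinAt
  have hnorm (r : ℂ) {t : ℝ} (ht : 0 < t) :
      ‖(t : ℂ) ^ (a - 1) * Complex.exp (-(r * t))‖ =
        t ^ (a.re - 1) * Real.exp (-r.re * t) := by
    rw [norm_mul, Complex.norm_cpow_eq_rpow_re_of_pos ht, Complex.norm_exp]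
    simp
  refine (hasDerivAt_integral_of_dominated_loc_of_deriv_le
    (F' := fun r t ↦ (t : ℂ) ^ (a - 1) * Complex.exp (-(r * t)) * (-t))
    (bound := fun t ↦ t ^ a.re * Real.exp (-(r.re / 2) * t))
    (Metric.ball_mem_nhds r (half_pos hr)) ?_ ?_ ?_ ?_ ?_ ?_).2.differentiableAt
  · exact .of_forall fun r ↦ (hcont r).aestronglyMeasurable measurableSet_Ioi
  · refine (MeasureTheory.integrable_norm_iff
      ((hcont r).aestronglyMeasurable measurableSet_Ioi)).1 ?_
    have := integrableOn_rpow_mul_exp_neg_mul_rpow (p := 1) (s := a.re - 1) (b := r.re)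
      (by linarith) one_pos hr
    refine this.congr_fun (fun t ht ↦ ?_) measurableSet_Ioi
    simp only [Real.rpow_one]
    exact (hnorm r ht).symm
  · exact ((hcont r).mul (by fun_prop)).aestronglyMeasurable measurableSet_Ioi
  · refine (MeasureTheory.ae_restrict_iff' measurableSet_Ioi).2 (.of_forall fun t ht x hx ↦ ?_)
    have ht' : 0 < t := ht
    rw [norm_mul, hnorm x ht', norm_neg, Complex.norm_of_nonneg ht'.le, mul_right_comm,
      ← Real.rpow_add_one ht'.ne', sub_add_cancel]
    have h1 : r.re / 2 ≤ x.re := by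
      have h2 := (Complex.abs_re_le_norm (x - r)).trans (mem_ball_iff_norm.1 hx).le
      rw [Complex.sub_re] at h2
      linarith [(abs_le.1 h2).1]
    gcongr
  · have := integrableOn_rpow_mul_exp_neg_mul_rpow (p := 1) (s := a.re) (b := r.re / 2)
      (by linarith) one_pos (half_pos hr)
    simpa only [Real.rpow_one, MeasureTheory.IntegrableOn] using this
  · refine .of_forall fun t x _ ↦ ?_
    have h : HasDerivAt (fun x : ℂ ↦ -(x * t)) (-(t : ℂ)) x := by
      simpa using ((hasDerivAt_id' x).mul_const (t : ℂ)).fun_neg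
    simpa [mul_assoc] using h.cexp.const_mul ((t : ℂ) ^ (a - 1))

/-- Version of `Complex.integral_cpow_mul_exp_neg_mul_Ioi` for complex `r` in the right
half-plane. -/
lemma integral_cpow_mul_exp_neg_mul_Ioi_of_re_pos {a r : ℂ} (ha : 0 < a.re) (hr : 0 < r.re) :
    ∫ t : ℝ in Set.Ioi 0, (t : ℂ) ^ (a - 1) * Complex.exp (-(r * t)) =
      (1 / r) ^ a * Complex.Gamma a := by
  have hopen : IsOpen {r : ℂ | 0 < r.re} := isOpen_lt continuous_const Complex.continuous_re
  have hconv : Convex ℝ {r : ℂ | 0 < r.re} := convex_halfSpace_re_gt 0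
  have hL : AnalyticOnNhd ℂ
      (fun r : ℂ ↦ ∫ t : ℝ in Set.Ioi 0, (t : ℂ) ^ (a - 1) * Complex.exp (-(r * t)))
      {r : ℂ | 0 < r.re} :=
    DifferentiableOn.analyticOnNhd (fun r hr ↦
      (differentiableAt_integral_cpow_mul_exp_neg_mul_Ioi ha hr).differentiableWithinAt) hopen
  have hR : AnalyticOnNhd ℂ (fun r : ℂ ↦ (1 / r) ^ a * Complex.Gamma a) {r : ℂ | 0 < r.re} := by
    refine DifferentiableOn.analyticOnNhd (fun r hr ↦ ?_) hopen
    have hr' : 0 < r.re := hr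
    have h0 : r ≠ 0 := by rintro rfl; simp at hr'
    refine DifferentiableAt.differentiableWithinAt (.mul_const (.cpow_const ?_ ?_) _)
    · exact (differentiableAt_const _).div differentiableAt_id h0
    · left
      rw [one_div, Complex.inv_re]
      exact div_pos hr' (Complex.normSq_pos.2 h0)
  refine hL.eqOn_of_preconnected_of_frequently_eq hR hconv.isPreconnected (z₀ := 1)
    (by simp) ?_ hr
  have htend : Filter.Tendsto (fun x : ℝ ↦ (x : ℂ)) (nhdsWithin 1 {1}ᶜ)
      (nhdsWithin 1 {1}ᶜ) := by
    refine tendsto_nhdsWithin_iff.2 ⟨?_, ?_⟩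
    · exact (Complex.continuous_ofReal.tendsto' 1 1 (by simp)).mono_left nhdsWithin_le_nhds
    · filter_upwards [self_mem_nhdsWithin] with x hx
      simpa using hx
  refine htend.frequently (Filter.Eventually.frequently ?_)
  filter_upwards [mem_nhdsWithin_of_mem_nhds (lt_mem_nhds (zero_lt_one' ℝ))] with x hx
  exact Complex.integral_cpow_mul_exp_neg_mul_Ioi ha hx

/-- For `1 < re s` the series `∑ (w + n) ^ (-s)` converges absolutely. -/
lemma summable_norm_add_int_cpow_neg (w : ℂ) {s : ℂ} (hs : 1 < s.re) :
    Summable fun n : ℤ ↦ ‖(w + n) ^ (-s)‖ := by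
  have hO : (fun n : ℤ ↦ ‖(w + n) ^ (-s)‖) =O[Filter.cofinite]
      fun n : ℤ ↦ |(n : ℝ)| ^ (-s.re) := by
    have h1 : (fun n : ℤ ↦ ‖(w + n) ^ (-s)‖) =O[Filter.cofinite]
        fun n : ℤ ↦ ‖w + n‖⁻¹ ^ s.re := by
      refine .of_bound (Real.exp (Real.pi * |s.im|)) (.of_forall fun n ↦ ?_)
      rw [norm_norm, Real.norm_of_nonneg (by positivity)]
      refine (Complex.norm_cpow_le _ _).trans ?_
      rw [div_eq_mul_inv, mul_comm, ← Real.exp_neg, Complex.neg_re, Complex.neg_im,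
        Real.rpow_neg (norm_nonneg _), Real.inv_rpow (norm_nonneg _), mul_neg, neg_neg]
      refine mul_le_mul_of_nonneg_right (Real.exp_le_exp.2 ?_) (by positivity)
      refine (le_abs_self _).trans ?_
      rw [abs_mul]
      exact mul_le_mul_of_nonneg_right (Complex.abs_arg_le_pi _) (abs_nonneg _)
    have h2 : (fun n : ℤ ↦ ‖w + n‖⁻¹) =O[Filter.cofinite] fun n : ℤ ↦ |(n : ℝ)|⁻¹ := by
      simpa using (EisensteinSeries.linear_inv_isBigO_right 1 w).norm_norm
    refine h1.trans ((h2.rpow (zero_le_one.trans hs.le)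
      (.of_forall fun n ↦ by positivity)).trans
      (Asymptotics.isBigO_of_le _ fun n ↦ le_of_eq ?_))
    rw [Real.inv_rpow (abs_nonneg _), Real.rpow_neg (abs_nonneg _)]
  exact summable_of_isBigO (Real.summable_abs_int_rpow hs) hO

/-- Rotating the upper half-plane to the right half-plane by `-I` in a principal power. -/
lemma one_div_two_pi_neg_I_mul_cpow {u : ℂ} (hu : 0 < u.im) (s : ℂ) :
    (1 / ((2 * Real.pi : ℝ) * (-Complex.I * u))) ^ s =
      ((2 * Real.pi : ℝ) : ℂ) ^ (-s) * (Complex.exp (Real.pi * Complex.I * s / 2) * u ^ (-s)) := by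
  have hu0 : u ≠ 0 := by rintro rfl; simp at hu
  have h2pi : (0 : ℝ) < 2 * Real.pi := by positivity
  have hre : 0 < (((2 * Real.pi : ℝ) : ℂ) * (-Complex.I * u)).re := by
    rw [Complex.re_ofReal_mul]
    simp only [neg_mul, Complex.neg_re, Complex.mul_re, Complex.I_re, Complex.I_im]
    nlinarith
  have harg : (((2 * Real.pi : ℝ) : ℂ) * (-Complex.I * u)).arg ≠ Real.pi := by
    intro h
    rw [Complex.arg_eq_pi_iff] at h
    linarith [h.1]
  have hlog : Complex.log (-Complex.I * u) = -(Real.pi / 2 * Complex.I) + Complex.log u := by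
    rw [Complex.log_mul (by simp) hu0, Complex.log_neg_I]
    · ring
    · have h1 := Complex.arg_nonneg_iff.2 hu.le
      have h2 := Complex.arg_le_pi u
      rw [Complex.arg_neg_I]
      constructor <;> linarith [Real.pi_pos]
  rw [one_div, Complex.inv_cpow _ _ harg, ← Complex.cpow_neg,
    Complex.cpow_def_of_ne_zero (by simp [hu0, Real.pi_ne_zero]),
    Complex.log_ofReal_mul h2pi (by simp [hu0]), hlog,
    Complex.cpow_def_of_ne_zero hu0, Complex.cpow_def_of_ne_zero (by exact_mod_cast h2pi.ne'),
    ← Complex.exp_add, ← Complex.exp_add, Complex.ofReal_log h2pi.le]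
  congr 1
  ring

/-- The function `x ↦ x ^ (s - 1) * exp (2 π i x w)` on the positive reals, extended by zero. -/
noncomputable def lipschitzKernel (s w : ℂ) (x : ℝ) : ℂ :=
  ((max x 0 : ℝ) : ℂ) ^ (s - 1) * Complex.exp (2 * Real.pi * Complex.I * x * w)

lemma lipschitzKernel_of_nonpos {s : ℂ} (hs : 1 < s.re) (w : ℂ) {x : ℝ} (hx : x ≤ 0) :
    lipschitzKernel s w x = 0 := by
  have : s - 1 ≠ 0 := fun h ↦ by
    rw [sub_eq_zero.1 h] at hs
    simp at hs
  simp [lipschitzKernel, max_eq_right hx, Complex.zero_cpow this]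

lemma lipschitzKernel_of_pos (s w : ℂ) {x : ℝ} (hx : 0 < x) :
    lipschitzKernel s w x = (x : ℂ) ^ (s - 1) * Complex.exp (2 * Real.pi * Complex.I * x * w) := by
  simp [lipschitzKernel, max_eq_left hx.le]

lemma continuous_lipschitzKernel {s : ℂ} (hs : 1 < s.re) (w : ℂ) :
    Continuous (lipschitzKernel s w) := by
  have h : Continuous fun x : ℝ ↦ (x : ℂ) ^ (s - 1) :=
    Complex.continuous_ofReal_cpow_const (by simpa using hs)
  exact (h.comp (continuous_id.max continuous_const)).mul (by fun_prop)

lemma lipschitzKernel_isBigO {s w : ℂ} (hs : 1 < s.re) (hw : 0 < w.im) :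
    lipschitzKernel s w =O[Filter.cocompact ℝ] fun x : ℝ ↦ |x| ^ (-2 : ℝ) := by
  rw [cocompact_eq_atBot_atTop, Asymptotics.isBigO_sup]
  constructor
  · refine Asymptotics.IsBigO.of_bound 1 ?_
    filter_upwards [Filter.eventually_le_atBot 0] with x hx
    rw [lipschitzKernel_of_nonpos hs w hx, norm_zero]
    positivity
  · have h := (isLittleO_exp_neg_mul_rpow_atTop (a := 2 * Real.pi * w.im) (by positivity)
      (-2 - (s.re - 1))).isBigO
    refine (((Asymptotics.isBigO_refl (fun x : ℝ ↦ x ^ (s.re - 1)) _).mul h).congr'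
      ?_ ?_).of_norm_left
    · filter_upwards [Filter.eventually_gt_atTop 0] with x hx
      rw [lipschitzKernel_of_pos s w hx, norm_mul, Complex.norm_cpow_eq_rpow_re_of_pos hx,
        Complex.norm_exp]
      simp [mul_right_comm]
    · filter_upwards [Filter.eventually_gt_atTop 0] with x hx
      rw [← Real.rpow_add hx, abs_of_pos hx]
      congr 1
      ring

lemma fourier_lipschitzKernel {s w : ℂ} (hs : 1 < s.re) (hw : 0 < w.im) (ξ : ℝ) :
    FourierTransform.fourier (lipschitzKernel s w) ξ =
      ((2 * Real.pi : ℝ) : ℂ) ^ (-s) * (Complex.exp (Real.pi * Complex.I * s / 2) * (w - ξ) ^ (-s)) *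
        Complex.Gamma s := by
  have hu : 0 < (w - ξ).im := by simpa using hw
  have hre : 0 < (((2 * Real.pi : ℝ) : ℂ) * (-Complex.I * (w - ξ))).re := by
    rw [Complex.re_ofReal_mul]
    have : (-Complex.I * (w - ξ)).re = w.im := by simp
    rw [this]
    positivity
  rw [← one_div_two_pi_neg_I_mul_cpow hu,
    ← integral_cpow_mul_exp_neg_mul_Ioi_of_re_pos (zero_lt_one.trans hs) hre,
    Real.fourier_real_eq_integral_exp_smul,
    ← MeasureTheory.setIntegral_eq_integral_of_forall_compl_eq_zero (s := Set.Ioi 0)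
      (fun x hx ↦ by rw [lipschitzKernel_of_nonpos hs w (not_lt.1 hx), smul_zero])]
  refine MeasureTheory.setIntegral_congr_fun measurableSet_Ioi fun x hx ↦ ?_
  simp only [smul_eq_mul]
  rw [lipschitzKernel_of_pos s w hx, mul_left_comm, ← Complex.exp_add]
  congr 2
  push_cast
  ring

/-- The **Lipschitz summation formula** with a complex exponent. -/
lemma lipschitz_summation {s w : ℂ} (hs : 1 < s.re) (hw : 0 < w.im) :
    Complex.exp (Real.pi * Complex.I * s / 2) * Complex.Gamma s * ∑' n : ℤ, (w + n) ^ (-s) =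
      ((2 * Real.pi : ℝ) : ℂ) ^ s *
        ∑' m : ℕ+, (m : ℂ) ^ (s - 1) * Complex.exp (2 * Real.pi * Complex.I * m * w) := by
  have hsum : Summable fun n : ℤ ↦ (w - n) ^ (-s) := by
    have := (summable_norm_add_int_cpow_neg w hs).of_norm.comp_injective neg_injective
    simpa [Function.comp_def, sub_eq_add_neg] using this
  have hneg : ∑' n : ℤ, (w - n) ^ (-s) = ∑' n : ℤ, (w + n) ^ (-s) := by
    rw [← (Equiv.neg ℤ).tsum_eq]
    simp [sub_eq_add_neg]
  have hpoisson := Real.tsum_eq_tsum_fourier_of_rpow_decay_of_summable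
    (continuous_lipschitzKernel hs w) one_lt_two (lipschitzKernel_isBigO hs hw)
    (by
      simp_rw [fourier_lipschitzKernel hs hw]
      exact ((hsum.mul_left _).mul_left _).mul_right _) 0
  have hpnat : ∑' n : ℤ, lipschitzKernel s w n =
      ∑' m : ℕ+, (m : ℂ) ^ (s - 1) * Complex.exp (2 * Real.pi * Complex.I * m * w) := by
    have hinj : Function.Injective fun m : ℕ+ ↦ (m : ℤ) := fun m n h ↦ by
      simpa using h
    rw [← hinj.tsum_eq]
    · refine tsum_congr fun m ↦ ?_
      rw [lipschitzKernel_of_pos s w (by simp)]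
      simp
    · intro n hn
      have h0 : 0 < n := by
        by_contra h
        exact hn (lipschitzKernel_of_nonpos hs w (by exact_mod_cast not_lt.1 h))
      exact ⟨⟨n.toNat, by lia⟩, by simp [h0.le]⟩
  simp only [zero_add, QuotientAddGroup.mk_zero, fourier_eval_zero, mul_one,
    fourier_lipschitzKernel hs hw] at hpoisson
  rw [← hpnat, hpoisson, tsum_mul_right, tsum_mul_left, tsum_mul_left]
  simp only [Complex.ofReal_intCast, hneg]
  rw [Complex.cpow_neg]
  have h2pi : ((2 * Real.pi : ℝ) : ℂ) ^ s ≠ 0 := by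
    simp [Complex.cpow_eq_zero_iff, Real.pi_ne_zero]
  field_simp

lemma im_moebius_pos {a b c d : ℤ} (h : a * d - b * c = 1) (z : UpperHalfPlane) :
    0 < (((a : ℂ) * z + b) / ((c : ℂ) * z + d)).im := by
  have hz := z.im_pos
  have h' : (a : ℝ) * d - b * c = 1 := by exact_mod_cast h
  have hden : (c : ℂ) * z + d ≠ 0 := by
    intro h0
    have him := congrArg Complex.im h0
    have hre := congrArg Complex.re h0
    simp [hz.ne'] at him
    simp [him] at hre
    simp [him, hre] at h
  have hpos := Complex.normSq_pos.2 hden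
  have hdiv : (((a : ℂ) * z + b) / ((c : ℂ) * z + d)).im =
      z.im / Complex.normSq ((c : ℂ) * z + d) := by
    rw [Complex.div_im, ← sub_div]
    congr 1
    simp
    linear_combination z.im * h'
  rw [hdiv]
  positivity

/-- Unfolding against the Lipschitz formula: for a weighted family of points in the upper
half-plane, summing `∑ (w i + n) ^ (-s)` over the family amounts to interchanging two sums. -/
lemma lipschitz_unfolding {ι : Type*} {s : ℂ} (hs : 1 < s.re) (G : ℂ) {w : ι → ℂ}
    (hw : ∀ i, 0 < (w i).im) (A : ι → ℂ)
    (h_sum : Summable fun q : ι × ℕ+ ↦ ‖A q.1 * (q.2 : ℂ) ^ (s - 1) *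
      Complex.exp (2 * Real.pi * Complex.I * q.2 * w q.1)‖) :
    (∀ i, Summable fun n : ℤ ↦ ‖(w i + n) ^ (-s)‖) ∧
    (Summable fun i ↦ ‖A i * ∑' n : ℤ, (w i + n) ^ (-s)‖) ∧
    (∀ m : ℕ+, Summable fun i ↦
      ‖A i * Complex.exp (2 * Real.pi * Complex.I * m * w i)‖) ∧
    (Summable fun m : ℕ+ ↦ ‖(m : ℂ) ^ (s - 1) * ((1 / 2 : ℂ) *
      ∑' i, A i * Complex.exp (2 * Real.pi * Complex.I * m * w i))‖) ∧
    (1 / 2 : ℂ) * Complex.exp (Real.pi * Complex.I * s / 2) * Complex.Gamma s * G *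
        ∑' i, A i * ∑' n : ℤ, (w i + n) ^ (-s) =
      ((2 * Real.pi : ℝ) : ℂ) ^ s * G * ∑' m : ℕ+, (m : ℂ) ^ (s - 1) * ((1 / 2 : ℂ) *
        ∑' i, A i * Complex.exp (2 * Real.pi * Complex.I * m * w i)) := by
  set E : ℂ := Complex.exp (Real.pi * Complex.I * s / 2) * Complex.Gamma s with hE
  set T : ℂ := ((2 * Real.pi : ℝ) : ℂ) ^ s with hT
  set F : ι × ℕ+ → ℂ := fun q ↦ A q.1 * (q.2 : ℂ) ^ (s - 1) *
    Complex.exp (2 * Real.pi * Complex.I * q.2 * w q.1) with hF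
  have hE0 : E ≠ 0 :=
    mul_ne_zero (Complex.exp_ne_zero _) (Complex.Gamma_ne_zero_of_re_pos (zero_lt_one.trans hs))
  have hFs : Summable fun q ↦ ‖F q‖ := h_sum
  have hlip (p : ι) : A p * ∑' n : ℤ, (w p + n) ^ (-s) =
      E⁻¹ * T * ∑' m : ℕ+, F (p, m) := by
    have h := lipschitz_summation hs (hw p)
    simp only [hF, mul_assoc (A p)]
    rw [tsum_mul_left, mul_left_comm, mul_assoc, ← h, ← hE, inv_mul_cancel_left₀ hE0]
  have hcoeff (m : ℕ+) : (m : ℂ) ^ (s - 1) ≠ 0 := by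
    simp [Complex.cpow_eq_zero_iff]
  have hcol (m : ℕ+) : (m : ℂ) ^ (s - 1) * ((1 / 2 : ℂ) *
      ∑' p, A p * Complex.exp (2 * Real.pi * Complex.I * m * w p)) =
      1 / 2 * ∑' p, F (p, m) := by
    rw [mul_left_comm, ← tsum_mul_left]
    congr 1
    refine tsum_congr fun p ↦ ?_
    simp only [hF]
    ring
  have hrow : Summable fun p ↦ ‖∑' m, F (p, m)‖ :=
    hFs.prod.of_nonneg_of_le (fun _ ↦ norm_nonneg _)
      fun p ↦ norm_tsum_le_tsum_norm (hFs.prod_factor p)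
  have hFs' : Summable fun q : ℕ+ × ι ↦ ‖F q.swap‖ := hFs.prod_symm
  refine ⟨fun p ↦ summable_norm_add_int_cpow_neg (w p) hs, ?_, fun m ↦ ?_, ?_, ?_⟩
  · simp_rw [hlip, norm_mul (E⁻¹ * T)]
    exact hrow.mul_left _
  · refine ((hFs'.prod_factor m).mul_left ‖(m : ℂ) ^ (s - 1)‖⁻¹).congr fun p ↦ ?_
    simp only [hF, Prod.swap_prod_mk, norm_mul]
    field_simp [norm_ne_zero_iff.2 (hcoeff m)]
  · simp_rw [hcol, norm_mul (1 / 2 : ℂ)]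
    exact (hFs'.prod.of_nonneg_of_le (fun _ ↦ norm_nonneg _)
      fun m ↦ norm_tsum_le_tsum_norm (hFs'.prod_factor m)).mul_left _
  · simp_rw [hcol, hlip, tsum_mul_left]
    rw [Summable.tsum_comm (f := fun p m ↦ F (p, m)) hFs.of_norm, mul_assoc (1 / 2 : ℂ), ← hE]
    field_simp

/-- Unfolding identity for the kernel function
`R_{s,ψ} = (2π)^s Γ(κ−s) ∑_{m≥1} m^{s−1} P_{m}`, for an arbitrary bounded
multiplier system `W` making the double series absolutely summable; all the
indicated series converge absolutely. -/
theorem kernel_unfolding (N : ℤ) (hN : 1 ≤ N) (κ : ℝ) (z : UpperHalfPlane)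
    (s : ℂ) (hs : 1 < s.re)
    (a b : PoincareIndex N → ℤ)
    (hab : ∀ p : PoincareIndex N, a p * p.1.2 - b p * p.1.1 = 1)
    (w : PoincareIndex N → ℂ)
    (hw : ∀ p : PoincareIndex N,
      w p = ((a p : ℂ) * z + b p) / ((p.1.1 : ℂ) * z + p.1.2))
    (W : PoincareIndex N → ℂ)
    (hW : Summable (fun q : PoincareIndex N × ℕ+ =>
      ‖W q.1 * ((q.1.1.1 : ℂ) * z + q.1.1.2) ^ (-(κ : ℂ)) * (q.2 : ℂ) ^ (s - 1) *
        Complex.exp (2 * Real.pi * Complex.I * q.2 * w q.1)‖)) :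
    (∀ p : PoincareIndex N, Summable (fun n : ℤ => ‖(w p + n) ^ (-s)‖)) ∧
    Summable (fun p : PoincareIndex N =>
      ‖W p * ((p.1.1 : ℂ) * z + p.1.2) ^ (-(κ : ℂ)) *
        ∑' n : ℤ, (w p + n) ^ (-s)‖) ∧
    (∀ m : ℕ+, Summable (fun p : PoincareIndex N =>
      ‖W p * ((p.1.1 : ℂ) * z + p.1.2) ^ (-(κ : ℂ)) *
        Complex.exp (2 * Real.pi * Complex.I * m * w p)‖)) ∧
    Summable (fun m : ℕ+ =>
      ‖(m : ℂ) ^ (s - 1) * ((1 / 2 : ℂ) *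
        ∑' p : PoincareIndex N, W p * ((p.1.1 : ℂ) * z + p.1.2) ^ (-(κ : ℂ)) *
          Complex.exp (2 * Real.pi * Complex.I * m * w p))‖) ∧
    (1 / 2 : ℂ) * Complex.exp (Real.pi * Complex.I * s / 2) * Complex.Gamma s *
        Complex.Gamma ((κ : ℂ) - s) *
        ∑' p : PoincareIndex N, W p * ((p.1.1 : ℂ) * z + p.1.2) ^ (-(κ : ℂ)) *
          ∑' n : ℤ, (w p + n) ^ (-s) =
      ((2 * Real.pi : ℝ) : ℂ) ^ s * Complex.Gamma ((κ : ℂ) - s) *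
        ∑' m : ℕ+, (m : ℂ) ^ (s - 1) * ((1 / 2 : ℂ) *
          ∑' p : PoincareIndex N, W p * ((p.1.1 : ℂ) * z + p.1.2) ^ (-(κ : ℂ)) *
            Complex.exp (2 * Real.pi * Complex.I * m * w p)) := by
  have him (p : PoincareIndex N) : 0 < (w p).im := by
    rw [hw p]
    exact im_moebius_pos (hab p) z
  exact lipschitz_unfolding hs (Complex.Gamma ((κ : ℂ) - s)) him _ hW
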